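/- arXiv:math/9906058 — 2 statements merged into one kernel-verified Lean document; each statement's English description precedes it below -/
import Mathlib

section
/- Let n ≥ 4 be an integer and let r ∈ (−1, 1). Then the Cauchy principal value integral ⨍_{−1}^{1} U_n(s)·(1−s²)^{5/2}/(s−r) ds exists and equals −(π/16)·[T_{n−3}(r) − 4·T_{n−1}(r) + 6·T_{n+1}(r) − 4·T_{n+3}(r) + T_{n+5}(r)]. -/
open Polynomial in
/-- truncated principal value integral against the weight `√(1-s²)`. -/
noncomputable def pvInt (p : ℝ[X]) (r ε : ℝ) : ℝ :=
  (∫ s in (-1 : ℝ)..(r - ε), p.eval s * √(1 - s ^ 2) / (s - r)) +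
    ∫ s in (r + ε)..(1 : ℝ), p.eval s * √(1 - s ^ 2) / (s - r)

open Polynomial in
def HasPV (p : ℝ[X]) (r L : ℝ) : Prop :=
  Filter.Tendsto (pvInt p r) (nhdsWithin 0 (Set.Ioi 0)) (nhds L)

lemma pv_eventually (r : ℝ) (hr : r ∈ Set.Ioo (-1 : ℝ) 1) :
    ∀ᶠ ε in nhdsWithin (0 : ℝ) (Set.Ioi 0), 0 < ε ∧ -1 < r - ε ∧ r + ε < 1 := by
  have h1 : 0 < min (1 + r) (1 - r) := lt_min (by linarith [hr.1]) (by linarith [hr.2])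
  filter_upwards [Ioo_mem_nhdsGT h1] with ε hε
  have := lt_min_iff.1 hε.2
  exact ⟨hε.1, by linarith, by linarith⟩

open Polynomial in
lemma pv_int_left (p : ℝ[X]) (r ε : ℝ) (h : 0 < ε ∧ -1 < r - ε ∧ r + ε < 1) :
    IntervalIntegrable (fun s => p.eval s * √(1 - s ^ 2) / (s - r)) MeasureTheory.volume
      (-1) (r - ε) := by
  apply ContinuousOn.intervalIntegrable
  rw [Set.uIcc_of_le h.2.1.le]
  apply ContinuousOn.div (by fun_prop) (by fun_prop)
  intro s hs h0
  linarith [hs.2, h.1]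

open Polynomial in
lemma pv_int_right (p : ℝ[X]) (r ε : ℝ) (h : 0 < ε ∧ -1 < r - ε ∧ r + ε < 1) :
    IntervalIntegrable (fun s => p.eval s * √(1 - s ^ 2) / (s - r)) MeasureTheory.volume
      (r + ε) 1 := by
  apply ContinuousOn.intervalIntegrable
  rw [Set.uIcc_of_le h.2.2.le]
  apply ContinuousOn.div (by fun_prop) (by fun_prop)
  intro s hs h0
  linarith [hs.1, h.1]

open Polynomial in
lemma HasPV.add {p q : ℝ[X]} {r L M : ℝ} (hr : r ∈ Set.Ioo (-1 : ℝ) 1)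
    (hp : HasPV p r L) (hq : HasPV q r M) : HasPV (p + q) r (L + M) := by
  refine (Filter.Tendsto.add hp hq).congr' ?_
  filter_upwards [pv_eventually r hr] with ε hε
  unfold pvInt
  simp only [eval_add, add_mul, add_div]
  rw [intervalIntegral.integral_add (pv_int_left p r ε hε) (pv_int_left q r ε hε),
    intervalIntegral.integral_add (pv_int_right p r ε hε) (pv_int_right q r ε hε)]
  ring

open Polynomial in
lemma HasPV.const_mul {p : ℝ[X]} {r L : ℝ} (a : ℝ)
    (hp : HasPV p r L) : HasPV (C a * p) r (a * L) := by
  refine (Filter.Tendsto.const_mul a hp).congr fun ε => ?_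
  unfold pvInt
  simp only [eval_mul, eval_C, mul_assoc, mul_div_assoc]
  rw [intervalIntegral.integral_const_mul, intervalIntegral.integral_const_mul]
  ring

open Polynomial in
lemma hasPV_X_sub (p : ℝ[X]) {r : ℝ} (hr : r ∈ Set.Ioo (-1 : ℝ) 1) :
    HasPV ((X - C r) * p) r (∫ s in (-1 : ℝ)..1, p.eval s * √(1 - s ^ 2)) := by
  have hc : Continuous fun s : ℝ => p.eval s * √(1 - s ^ 2) := by fun_prop
  have hi : ∀ a b : ℝ, IntervalIntegrable (fun s : ℝ => p.eval s * √(1 - s ^ 2))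
      MeasureTheory.volume a b := fun a b => hc.intervalIntegrable a b
  have hF := intervalIntegral.continuous_primitive hi (-1)
  have h1 : Filter.Tendsto (fun ε : ℝ => (∫ s in (-1 : ℝ)..(r - ε), p.eval s * √(1 - s ^ 2)) +
      ((∫ s in (-1 : ℝ)..1, p.eval s * √(1 - s ^ 2)) -
        ∫ s in (-1 : ℝ)..(r + ε), p.eval s * √(1 - s ^ 2))) (nhds 0)
      (nhds (∫ s in (-1 : ℝ)..1, p.eval s * √(1 - s ^ 2))) := by
    have : Continuous (fun ε : ℝ => (∫ s in (-1 : ℝ)..(r - ε), p.eval s * √(1 - s ^ 2)) +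
      ((∫ s in (-1 : ℝ)..1, p.eval s * √(1 - s ^ 2)) -
        ∫ s in (-1 : ℝ)..(r + ε), p.eval s * √(1 - s ^ 2))) :=
      (hF.comp (continuous_const.sub continuous_id)).add
        (continuous_const.sub (hF.comp (continuous_const.add continuous_id)))
    have h2 := this.tendsto 0
    simpa using h2
  refine (h1.mono_left nhdsWithin_le_nhds).congr' ?_
  filter_upwards [pv_eventually r hr] with ε hε
  rw [intervalIntegral.integral_interval_sub_left (hi _ _) (hi _ _)]
  unfold pvInt
  congr 1
  · apply intervalIntegral.integral_congr
    intro s hs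
    rw [Set.uIcc_of_le hε.2.1.le] at hs
    have : s - r ≠ 0 := by intro h0; linarith [hs.2, hε.1]
    simp
    field_simp
  · apply intervalIntegral.integral_congr
    intro s hs
    rw [Set.uIcc_of_le hε.2.2.le] at hs
    have : s - r ≠ 0 := by intro h0; linarith [hs.1, hε.1]
    simp
    field_simp

lemma pv_alg (r s v w D : ℝ) (hw : w ≠ 0) (hv : v ≠ 0) (hs : s - r ≠ 0) (hD : D ≠ 0)
    (hDe : D = 1 - r * s + w * v) (hv2 : v ^ 2 = 1 - s ^ 2) (hw2 : w ^ 2 = 1 - r ^ 2) :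
    w * (1 / (s - r)) - w * ((-(r * 1) + w * (-s / v)) / D) = w ^ 2 / (v * (s - r)) := by
  have h : w * (D * v) - w * (s - r) * (-(r * v) - w * s) = w ^ 2 * D := by
    rw [hDe]
    linear_combination w ^ 2 * hv2 - w * v * hw2
  have e : w * (1 / (s - r)) - w * ((-(r * 1) + w * (-s / v)) / D)
      = (w * (D * v) - w * (s - r) * (-(r * v) - w * s)) / (v * (s - r) * D) := by
    field_simp
    ring
  rw [e, h, mul_div_mul_right _ _ hD]

open Polynomial in
lemma hasPV_one {r : ℝ} (hr : r ∈ Set.Ioo (-1 : ℝ) 1) :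
    HasPV 1 r (-Real.pi * r) := by
  obtain ⟨hr1, hr2⟩ := hr
  set w := √(1 - r ^ 2) with hw
  have hw0 : 0 < 1 - r ^ 2 := by nlinarith
  have hwp : 0 < w := Real.sqrt_pos.2 hw0
  have hw2 : w ^ 2 = 1 - r ^ 2 := Real.sq_sqrt hw0.le
  let G : ℝ → ℝ := fun s => √(1 - s ^ 2) - r * Real.arcsin s
    - w * Real.log (1 - r * s + w * √(1 - s ^ 2))
  let F : ℝ → ℝ := fun s => G s + w * Real.log (s - r)
  have hD : ∀ s ∈ Set.Icc (-1 : ℝ) 1, 0 < 1 - r * s + w * √(1 - s ^ 2) := by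
    intro s hs
    have h1 : 0 < 1 - r * s := by
      obtain ⟨a, b⟩ := hs
      nlinarith [mul_nonneg (sub_nonneg.2 hr1.le) (sub_nonneg.2 a),
        mul_nonneg (sub_nonneg.2 hr2.le) (sub_nonneg.2 b),
        mul_nonneg (sub_nonneg.2 hr1.le) (sub_nonneg.2 b),
        mul_nonneg (sub_nonneg.2 hr2.le) (sub_nonneg.2 a)]
    positivity
  have hGc : ContinuousOn G (Set.Icc (-1) 1) := by
    apply ContinuousOn.sub (by fun_prop)
    apply ContinuousOn.mul (by fun_prop)
    exact ContinuousOn.log (by fun_prop) fun s hs => (hD s hs).ne'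
  have hFc : ∀ S ⊆ Set.Icc (-1 : ℝ) 1, r ∉ S → ContinuousOn F S := by
    intro S hS hrS
    apply (hGc.mono hS).add
    apply ContinuousOn.mul (by fun_prop)
    refine ContinuousOn.log (by fun_prop) fun s hs h0 => hrS ?_
    rwa [← sub_eq_zero.1 h0]
  have hFd : ∀ s ∈ Set.Ioo (-1 : ℝ) 1, s ≠ r →
      HasDerivAt F ((1 : ℝ[X]).eval s * √(1 - s ^ 2) / (s - r)) s := by
    intro s hs hsr
    have hv0 : 0 < 1 - s ^ 2 := by nlinarith [hs.1, hs.2]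
    have hsr' : s - r ≠ 0 := sub_ne_zero.2 hsr
    have hDs := hD s ⟨hs.1.le, hs.2.le⟩
    have hv : HasDerivAt (fun s : ℝ => √(1 - s ^ 2)) (-s / √(1 - s ^ 2)) s := by
      have h0 : HasDerivAt (fun s : ℝ => 1 - s ^ 2) (-(2 * s)) s := by
        simpa using (hasDerivAt_pow 2 s).const_sub 1
      refine (h0.sqrt hv0.ne').congr_deriv ?_
      rw [← mul_neg, mul_div_mul_left _ _ (by norm_num)]
    have ha := (Real.hasDerivAt_arcsin hs.1.ne' hs.2.ne).const_mul r
    have hl := ((((hasDerivAt_id s).const_mul r).const_sub 1).add (hv.const_mul w)).log hDs.ne'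
    have hl2 := (((hasDerivAt_id s).sub_const r).log hsr').const_mul w
    have h := ((hv.sub ha).sub (hl.const_mul w)).add hl2
    refine h.congr_deriv ?_
    have hvp : 0 < √(1 - s ^ 2) := Real.sqrt_pos.2 hv0
    have hv2 : √(1 - s ^ 2) ^ 2 = 1 - s ^ 2 := Real.sq_sqrt hv0.le
    simp only [eval_one, id, Pi.add_apply]
    generalize √(1 - s ^ 2) = v at *
    have e : w * (1 / (s - r)) - w * ((-(r * 1) + w * (-s / v)) / (1 - r * s + w * v))
        = w ^ 2 / (v * (s - r)) := by
      exact pv_alg r s v w _ hwp.ne' hvp.ne' hsr' hDs.ne' rfl hv2 hw2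
    have e2 : -s / v - r * (1 / v) + w ^ 2 / (v * (s - r)) = 1 * v / (s - r) := by
      rw [hw2]
      field_simp
      rw [hv2]; ring
    linarith
  have hGt : Filter.Tendsto (fun ε : ℝ => (G (r - ε) - G (r + ε)) + (-Real.pi * r)) (nhds 0)
      (nhds (-Real.pi * r)) := by
    have hG : ContinuousAt G r := hGc.continuousAt (Icc_mem_nhds hr1 hr2)
    have t1 : Filter.Tendsto (fun ε : ℝ => r - ε) (nhds 0) (nhds r) := by
      have : Continuous fun ε : ℝ => r - ε := by fun_prop
      simpa using this.tendsto 0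
    have t2 : Filter.Tendsto (fun ε : ℝ => r + ε) (nhds 0) (nhds r) := by
      have : Continuous fun ε : ℝ => r + ε := by fun_prop
      simpa using this.tendsto 0
    simpa using ((hG.tendsto.comp t1).sub (hG.tendsto.comp t2)).add_const (-Real.pi * r)
  refine (hGt.mono_left nhdsWithin_le_nhds).congr' ?_
  filter_upwards [pv_eventually r ⟨hr1, hr2⟩] with ε hε
  have hε' := hε
  obtain ⟨e0, e1, e2⟩ := hε'
  unfold pvInt
  rw [intervalIntegral.integral_eq_sub_of_hasDerivAt_of_le e1.le
      (hFc _ (fun s hs => ⟨hs.1, by linarith [hs.2]⟩) (fun h => by linarith [h.2]))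
      (fun s hs => hFd s ⟨hs.1, by linarith [hs.2]⟩ (by rintro rfl; linarith [hs.2]))
      (pv_int_left 1 r ε hε),
    intervalIntegral.integral_eq_sub_of_hasDerivAt_of_le e2.le
      (hFc _ (fun s hs => ⟨by linarith [hs.1], hs.2⟩) (fun h => by linarith [h.1]))
      (fun s hs => hFd s ⟨by linarith [hs.1], hs.2⟩ (by rintro rfl; linarith [hs.1]))
      (pv_int_right 1 r ε hε)]
  have l1 : Real.log (r - ε - r) = Real.log ε := by
    rw [← Real.log_neg_eq_log]; congr 1; ring
  have l2 : Real.log (r + ε - r) = Real.log ε := by congr 1; ring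
  have l3 : Real.log (-1 - r) = Real.log (1 + r) := by
    rw [← Real.log_neg_eq_log]; congr 1; ring
  simp only [F, l1, l2, l3]
  have g1 : G 1 = - r * (Real.pi / 2) - w * Real.log (1 - r) := by simp [G]
  have g2 : G (-1) = r * (Real.pi / 2) - w * Real.log (1 + r) := by simp [G]
  rw [g1, g2]; ring

open Polynomial Polynomial.Chebyshev in
lemma int_U (k : ℕ) : ∫ s in (-1 : ℝ)..1, (U ℝ ((k : ℤ) + 1)).eval s * √(1 - s ^ 2) = 0 := by
  have h : ∫ x, ((1/2 : ℝ) * ((T ℝ ((k : ℤ) + 1)).eval x - (T ℝ ((k : ℤ) + 3)).eval x)) ∂measureT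
      = 0 := by
    rw [MeasureTheory.integral_const_mul, MeasureTheory.integral_sub
      (integrable_measureT (by fun_prop)) (integrable_measureT (by fun_prop)),
      integral_eval_T_real_measureT_of_ne_zero (by omega),
      integral_eval_T_real_measureT_of_ne_zero (by omega)]
    simp
  rw [integral_measureT] at h
  rw [← h]
  apply intervalIntegral.integral_congr
  intro s hs
  rw [Set.uIcc_of_le (by norm_num)] at hs
  have hv0 : 0 ≤ 1 - s ^ 2 := by nlinarith [hs.1, hs.2]
  have e1 := congrArg (eval s) (one_sub_X_sq_mul_U_eq_pol_in_T ℝ ((k : ℤ) + 1))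
  have e2 := congrArg (eval s) (T_add_two ℝ ((k : ℤ) + 1))
  simp only [eval_mul, eval_sub, eval_one, eval_pow, eval_X, eval_ofNat] at e1 e2
  rw [show (k : ℤ) + 1 + 2 = k + 3 by ring] at e1 e2
  have e3 : (1/2 : ℝ) * ((T ℝ ((k : ℤ) + 1)).eval s - (T ℝ ((k : ℤ) + 3)).eval s)
      = (1 - s ^ 2) * (U ℝ ((k : ℤ) + 1)).eval s := by
    linarith
  simp only [e3]
  rw [Real.sqrt_inv]
  have : (1 - s ^ 2) * (√(1 - s ^ 2))⁻¹ = √(1 - s ^ 2) := by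
    rw [← div_eq_mul_inv, Real.div_sqrt]
  linear_combination -(U ℝ ((k : ℤ) + 1)).eval s * this

open Polynomial Polynomial.Chebyshev in
lemma hasPV_U {r : ℝ} (hr : r ∈ Set.Ioo (-1 : ℝ) 1) (k : ℕ) :
    HasPV (U ℝ k) r (-Real.pi * (T ℝ ((k : ℤ) + 1)).eval r) := by
  induction k using Nat.twoStepInduction with
  | zero => simpa using hasPV_one hr
  | one =>
    have h := ((hasPV_X_sub 1 hr).const_mul 2).add hr ((hasPV_one hr).const_mul (2 * r))
    simp only [eval_one, one_mul, integral_sqrt_one_sub_sq] at h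
    convert h using 1
    · have c : (Polynomial.C 2 : ℝ[X]) = 2 := rfl
      simp [c]; ring
    · simp; norm_num [T_two]; ring
  | more k h0 h1 =>
    have h := (((hasPV_X_sub (U ℝ ((k : ℤ) + 1)) hr).const_mul 2).add hr
      (h1.const_mul (2 * r))).add hr (h0.const_mul (-1))
    rw [int_U] at h
    convert h using 1
    · have c : (Polynomial.C 2 : ℝ[X]) = 2 := rfl
      push_cast
      rw [U_add_two]; simp [c]; ring
    · push_cast
      rw [show (k : ℤ) + 2 + 1 = (k + 1) + 2 by ring, T_add_two]; simp; ring

open Polynomial Polynomial.Chebyshev in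
lemma U_weight (n : ℤ) : (1 - X ^ 2) ^ 2 * U ℝ n = Polynomial.C (1/16) * (U ℝ (n - 4) +
    (Polynomial.C (-4) * U ℝ (n - 2) + (Polynomial.C 6 * U ℝ n + (Polynomial.C (-4) * U ℝ (n + 2) + U ℝ (n + 4))))) := by
  have h1 := U_add_two ℝ n
  have h2 := U_add_two ℝ (n + 1)
  have h3 := U_add_two ℝ (n + 2)
  have h4 := U_sub_one ℝ n
  have h5 := U_sub_two ℝ n
  have h6 := U_sub_two ℝ (n - 1)
  have h7 := U_sub_two ℝ (n - 2)
  rw [show n + 1 + 2 = n + 3 by ring, show n + 1 + 1 = n + 2 by ring] at h2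
  rw [show n + 2 + 2 = n + 4 by ring, show n + 2 + 1 = n + 3 by ring] at h3
  rw [show n - 1 - 2 = n - 3 by ring, show n - 1 - 1 = n - 2 by ring] at h6
  rw [show n - 2 - 2 = n - 4 by ring, show n - 2 - 1 = n - 3 by ring] at h7
  have c : (Polynomial.C (1/16) : ℝ[X]) * 16 = 1 := by
    rw [show (16 : ℝ[X]) = Polynomial.C 16 from rfl, ← Polynomial.C_mul]; norm_num
  have c2 : (Polynomial.C (-4) : ℝ[X]) = -4 := by
    rw [Polynomial.C_neg]; rfl
  have c3 : (Polynomial.C 6 : ℝ[X]) = 6 := rfl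
  rw [c2, c3, h3, h2, h1, h7, h6, h5, h4]
  linear_combination (-((1 - X ^ 2) ^ 2 * U ℝ n)) * c

/-- For an integer `n ≥ 4` and `r ∈ (-1, 1)`, the Cauchy principal value
integral `⨍_{-1}^{1} U_n(s) (1-s²)^{5/2}/(s-r) ds` exists and equals
`-(π/16) (T_{n-3}(r) - 4 T_{n-1}(r) + 6 T_{n+1}(r) - 4 T_{n+3}(r) + T_{n+5}(r))`. -/
theorem cpv_U_m3 (n : ℕ) (hn : 4 ≤ n) (r : ℝ) (hr : r ∈ Set.Ioo (-1 : ℝ) 1) :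
    Filter.Tendsto
      (fun ε : ℝ =>
        (∫ s in (-1 : ℝ)..(r - ε),
            (Polynomial.Chebyshev.U ℝ n).eval s * (1 - s ^ 2) ^ ((5 : ℝ) / 2) / (s - r)) +
        ∫ s in (r + ε)..(1 : ℝ),
            (Polynomial.Chebyshev.U ℝ n).eval s * (1 - s ^ 2) ^ ((5 : ℝ) / 2) / (s - r))
      (nhdsWithin 0 (Set.Ioi 0))
      (nhds (-(Real.pi / 16) *
        ((Polynomial.Chebyshev.T ℝ ((n : ℤ) - 3)).eval r -
         4 * (Polynomial.Chebyshev.T ℝ ((n : ℤ) - 1)).eval r +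
         6 * (Polynomial.Chebyshev.T ℝ ((n : ℤ) + 1)).eval r -
         4 * (Polynomial.Chebyshev.T ℝ ((n : ℤ) + 3)).eval r +
         (Polynomial.Chebyshev.T ℝ ((n : ℤ) + 5)).eval r))) := by
  have hU : ∀ j : ℤ, -4 ≤ j → HasPV (Polynomial.Chebyshev.U ℝ ((n : ℤ) + j)) r
      (-Real.pi * (Polynomial.Chebyshev.T ℝ ((n : ℤ) + j + 1)).eval r) := by
    intro j hj
    have h := hasPV_U hr ((n : ℤ) + j).toNat
    rwa [Int.toNat_of_nonneg (by omega)] at h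
  have h := ((hU (-4) (by norm_num)).add hr (((hU (-2) (by norm_num)).const_mul (-4)).add hr
    (((hU 0 (by norm_num)).const_mul 6).add hr (((hU 2 (by norm_num)).const_mul (-4)).add hr
    (hU 4 (by norm_num)))))).const_mul (1/16)
  simp only [← sub_eq_add_neg, add_zero] at h
  rw [← U_weight, show (n : ℤ) - 4 + 1 = n - 3 by ring, show (n : ℤ) - 2 + 1 = n - 1 by ring,
    show (n : ℤ) + 2 + 1 = n + 3 by ring, show (n : ℤ) + 4 + 1 = n + 5 by ring] at h
  have key : ∀ s ∈ Set.Icc (-1 : ℝ) 1,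
      ((1 - Polynomial.X ^ 2) ^ 2 * Polynomial.Chebyshev.U ℝ (n : ℤ)).eval s * √(1 - s ^ 2)
        / (s - r) =
      (Polynomial.Chebyshev.U ℝ n).eval s * (1 - s ^ 2) ^ ((5 : ℝ) / 2) / (s - r) := by
    intro s hs
    have hv0 : 0 ≤ 1 - s ^ 2 := by nlinarith [hs.1, hs.2]
    have e : (1 - s ^ 2) ^ ((5 : ℝ) / 2) = (1 - s ^ 2) ^ 2 * √(1 - s ^ 2) := by
      rw [show (5 : ℝ) / 2 = (2 : ℕ) + 1 / 2 by norm_num,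
        Real.rpow_add_of_nonneg hv0 (by positivity) (by positivity), Real.rpow_natCast,
        Real.sqrt_eq_rpow]
    rw [e]
    simp only [Polynomial.eval_mul, Polynomial.eval_pow, Polynomial.eval_sub,
      Polynomial.eval_one, Polynomial.eval_X]
    ring
  have h' := Filter.Tendsto.congr' (f₂ := fun ε : ℝ =>
        (∫ s in (-1 : ℝ)..(r - ε),
            (Polynomial.Chebyshev.U ℝ n).eval s * (1 - s ^ 2) ^ ((5 : ℝ) / 2) / (s - r)) +
        ∫ s in (r + ε)..(1 : ℝ),
            (Polynomial.Chebyshev.U ℝ n).eval s * (1 - s ^ 2) ^ ((5 : ℝ) / 2) / (s - r)) ?_ h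
  · convert h' using 2
    ring
  · filter_upwards [pv_eventually r hr] with ε hε
    unfold pvInt
    obtain ⟨e0, e1, e2⟩ := hε
    congr 1
    · apply intervalIntegral.integral_congr
      intro s hs
      rw [Set.uIcc_of_le e1.le] at hs
      exact key s ⟨hs.1, by linarith [hs.2]⟩
    · apply intervalIntegral.integral_congr
      intro s hs
      rw [Set.uIcc_of_le e2.le] at hs
      exact key s ⟨by linarith [hs.1], hs.2⟩
end

section
/- Let m ≥ 1 and n ≥ 2m + 3 be integers and define F : (−1, 1) → ℝ by F(r) = ⨍_{−1}^{1} T_n(s)·(1−s²)^{m−1/2}/(s−r) ds (Cauchy principal value). Then F is three times differentiable on (−1, 1) and F‴(r) = 6 · (−1)^{m+1}·(1/2)^{2m+2}·(1/3)·(π/(1−r²)²) · Σ_{j=0}^{2m−1} (−1)^j · C(2m−1, j) · (n+1−2m+2j) · { (n+2−2m+2j)(n+3−2m+2j)·U_{n−2−2m+2j}(r) − [2(n−2m+2j)² + 4(n−2m+2j) − 6]·U_{n−2m+2j}(r) + (n−2m+2j)(n−1−2m+2j)·U_{n+2−2m+2j}(r) }, where C(2m−1, j) denotes the binomial coefficient.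 (The quartic Hadamard finite-part integral ⨎_{−1}^{1} T_n(s)·(1−s²)^{m−1/2}/(s−r)⁴ ds equals F‴(r)/6.) -/
open Polynomial Polynomial.Chebyshev

theorem aux_Udd (N : ℤ) (s : ℝ) :
    4 * (1 - s ^ 2) ^ 2 * (derivative (derivative (U ℝ N))).eval s =
    ((N : ℝ) + 2) * ((N : ℝ) + 3) * (U ℝ (N - 2)).eval s
      - (2 * (N:ℝ) ^ 2 + 4 * (N : ℝ) - 6) * (U ℝ N).eval s
      + (N : ℝ) * ((N : ℝ) - 1) * (U ℝ (N + 2)).eval s := by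
  have h1 := congrArg (eval s) (one_sub_X_sq_mul_derivative_derivative_U_eq_poly_in_U (R := ℝ) N)
  have h2 := congrArg (eval s) (add_one_mul_T_eq_poly_in_U (R := ℝ) N)
  have h3 := congrArg (eval s) (two_mul_T_eq_U_sub_U ℝ (N - 1))
  have h4 := congrArg (eval s) (U_add_two ℝ N)
  have h5 := congrArg (eval s) (U_add_two ℝ (N - 1))
  have h6 := congrArg (eval s) (U_add_two ℝ (N - 2))
  rw [show N - 1 + 2 = N + 1 by ring] at h3 h5
  rw [show N - 1 + 1 = N by ring] at h5
  rw [show N - 2 + 2 = N by ring, show N - 2 + 1 = N - 1 by ring] at h6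
  simp only [Function.iterate_succ, Function.iterate_zero, Function.comp_apply, id, eval_mul,
    eval_sub, eval_add, eval_pow, eval_X, eval_one, eval_intCast, eval_ofNat] at h1 h2 h3 h4 h5 h6
  linear_combination 4 * (1 - s ^ 2) * h1 + 12 * s * h2 - 6 * s * (N + 1) * h3
    - ((6 + 2 * N * (N + 2)) * s) * h5 - ((N : ℝ) ^ 2 - N) * h4
    - (3 + N * (N + 2) + 3 * (N + 1) : ℝ) * h6

theorem aux_T2 (N : ℤ) (s : ℝ) : (T ℝ (N + 4)).eval s - 2 * (T ℝ (N + 2)).eval s + (T ℝ N).eval s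
    = -4 * (1 - s ^ 2) * (T ℝ (N + 2)).eval s := by
  have h := congrArg (eval s) (T_mul_T ℝ (N + 2) 2)
  rw [show N + 2 + 2 = N + 4 by ring, show N + 2 - 2 = N by ring, T_two] at h
  simp only [eval_mul, eval_sub, eval_add, eval_pow, eval_X, eval_one, eval_ofNat] at h
  linear_combination - h

theorem aux_fwd (p : ℕ) (s : ℝ) : ∀ N : ℤ, (fwdDiff (2 : ℤ))^[2 * p + 1] (fun k => (U ℝ k).eval s) N
    = (-4 * (1 - s ^ 2)) ^ p * (2 * (T ℝ (N + 2 * (p + 1))).eval s) := by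
  induction p with
  | zero =>
    intro N
    have h := congrArg (eval s) (two_mul_T_eq_U_sub_U ℝ N)
    simp only [eval_mul, eval_sub, eval_ofNat] at h
    simp only [fwdDiff, Nat.mul_zero, Nat.zero_add, Function.iterate_one, Nat.cast_zero, zero_add,
      mul_one, pow_zero, one_mul]
    rw [h]
  | succ p ih =>
    intro N
    rw [show 2 * (p + 1) + 1 = (2 * p + 1) + 1 + 1 by ring, Function.iterate_succ_apply',
      Function.iterate_succ_apply']
    simp only [fwdDiff, ih]
    have h := aux_T2 (N + 2 * (p + 1)) s
    push_cast
    rw [show N + 2 + 2 + 2 * ((p:ℤ) + 1) = N + 2 * (p + 1) + 4 by ring,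
      show N + 2 + 2 * ((p:ℤ) + 1) = N + 2 * (p + 1) + 2 by ring,
      show N + 2 * ((p:ℤ) + 1 + 1) = N + 2 * (p + 1) + 2 by ring]
    linear_combination 2 * (-4 * (1 - s ^ 2)) ^ p * h

theorem aux_expand (p : ℕ) (n : ℤ) (s : ℝ) : (T ℝ n).eval s * (1 - s ^ 2) ^ p =
    ∑ j ∈ Finset.range (2 * (p + 1)), ((-1 : ℝ) ^ (p + 1) * (1 / 2) ^ (2 * p + 1)) *
     ((-1 : ℝ) ^ j * ((2 * p + 1).choose j : ℝ)) * (U ℝ (n - 2 * (p + 1) + 2 * j)).eval s := by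
  have h := aux_fwd p s (n - 2 * (p + 1))
  rw [fwdDiff_iter_eq_sum_shift] at h
  have e : ∑ j ∈ Finset.range (2 * (p + 1)), ((-1 : ℝ) ^ j * ((2 * p + 1).choose j : ℝ)) *
      (U ℝ (n - 2 * (p + 1) + 2 * j)).eval s = - ((-4 * (1 - s ^ 2)) ^ p * (2 * (T ℝ n).eval s)) := by
    rw [show (T ℝ n) = T ℝ (n - 2 * ((p:ℤ) + 1) + 2 * (p + 1)) by congr 1; ring, ← h,
      ← Finset.sum_neg_distrib]
    refine Finset.sum_congr (by ring_nf) fun j hj => ?_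
    have hj' : j ≤ 2 * p + 1 := by have := Finset.mem_range.1 hj; omega
    have hs : (-1 : ℝ) ^ (2 * p + 1 - j) = - (-1) ^ j := by
      obtain ⟨d, hd⟩ := Nat.exists_eq_add_of_le hj'
      rw [hd, Nat.add_sub_cancel_left]
      have h1 : (-1 : ℝ) ^ (j + d) = -1 := by
        rw [← hd]; exact Odd.neg_one_pow ⟨p, rfl⟩
      rw [pow_add] at h1
      rcases neg_one_pow_eq_or ℝ j with h2 | h2 <;> rw [h2] at h1 ⊢ <;> linarith
    simp only [zsmul_eq_mul, nsmul_eq_mul]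
    push_cast
    rw [hs, mul_comm (2 : ℤ) (j : ℤ)]
    ring
  simp only [mul_assoc] at e ⊢
  rw [← Finset.mul_sum, ← Finset.mul_sum, e]
  rw [mul_pow, show (-4 : ℝ) ^ p = ((-1) ^ p * 2 ^ (2 * p)) by rw [pow_mul, ← mul_pow]; norm_num]
  have e2 : ((-1 : ℝ) ^ (p + 1) * (1 / 2) ^ (2 * p + 1)) * ((-1) ^ p * 2 ^ (2 * p)) * 2 = -1 := by
    have h1 : ((-1:ℝ)^p)*(-1)^p = 1 := by rw [← mul_pow]; simp
    have h2 : ((1/2:ℝ)^(2*p))*2^(2*p) = 1 := by rw [← mul_pow]; simp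
    rw [pow_succ, pow_succ]
    linear_combination -((1/2:ℝ)^(2*p))*2^(2*p) * h1 - h2
  linear_combination ((T ℝ n).eval s * (1 - s ^ 2) ^ p) * e2

/-- Primitive-based principal value. -/
structure PVal (f : ℝ → ℝ) (r L : ℝ) : Prop where
  cont : ContinuousOn f (Set.Icc (-1) 1 \ {r})
  prim : ∃ H : ℝ → ℝ, ContinuousOn H (Set.Icc (-1) 1 \ {r}) ∧
    (∀ s ∈ Set.Ioo (-1 : ℝ) 1, s ≠ r → HasDerivAt H (f s) s) ∧
    Filter.Tendsto (fun ε : ℝ => H (r - ε) - H (r + ε)) (nhdsWithin 0 (Set.Ioi 0)) (nhds 0) ∧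
    H 1 - H (-1) = L

theorem PVal.tendsto {f : ℝ → ℝ} {r L : ℝ} (h : PVal f r L) (hr : r ∈ Set.Ioo (-1 : ℝ) 1) :
    Filter.Tendsto (fun ε : ℝ => (∫ s in (-1 : ℝ)..(r - ε), f s) + ∫ s in (r + ε)..(1 : ℝ), f s)
      (nhdsWithin 0 (Set.Ioi 0)) (nhds L) := by
  obtain ⟨hc, H, hH, hd, ht, hL⟩ := h
  have ht' := ht.add_const L
  rw [zero_add] at ht'
  refine ht'.congr' ?_
  have hpos : 0 < min (r + 1) (1 - r) := lt_min (by linarith [hr.1]) (by linarith [hr.2])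
  filter_upwards [Ioo_mem_nhdsGT hpos] with ε hε
  have h1 : ε < r + 1 := hε.2.trans_le (min_le_left _ _)
  have h2 : ε < 1 - r := hε.2.trans_le (min_le_right _ _)
  have h0 : 0 < ε := hε.1
  have s1 : Set.Icc (-1) (r - ε) ⊆ Set.Icc (-1) 1 \ {r} := fun x hx =>
    ⟨⟨hx.1, by linarith [hx.2]⟩, fun e => by rw [Set.mem_singleton_iff] at e; linarith [hx.2]⟩
  have s2 : Set.Icc (r + ε) 1 ⊆ Set.Icc (-1) 1 \ {r} := fun x hx =>
    ⟨⟨by linarith [hx.1], hx.2⟩, fun e => by rw [Set.mem_singleton_iff] at e; linarith [hx.1]⟩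
  rw [intervalIntegral.integral_eq_sub_of_hasDerivAt_of_le (f := H) (by linarith) (hH.mono s1),
    intervalIntegral.integral_eq_sub_of_hasDerivAt_of_le (f := H) (by linarith) (hH.mono s2)]
  · linarith
  · intro x hx
    exact hd x ⟨by linarith [hx.1], hx.2⟩ (by linarith [hx.1] : r < x).ne'
  · exact ContinuousOn.intervalIntegrable_of_Icc (by linarith) (hc.mono s2)
  · intro x hx
    exact hd x ⟨hx.1, by linarith [hx.2]⟩ (by linarith [hx.2] : x < r).ne
  · exact ContinuousOn.intervalIntegrable_of_Icc (by linarith) (hc.mono s1)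

theorem PVal.add {f g : ℝ → ℝ} {r L M : ℝ} (hf : PVal f r L) (hg : PVal g r M) :
    PVal (fun s => f s + g s) r (L + M) := by
  obtain ⟨hc, H, hH, hd, ht, hL⟩ := hf
  obtain ⟨hc', H', hH', hd', ht', hL'⟩ := hg
  refine ⟨hc.add hc', fun s => H s + H' s, hH.add hH', fun s hs hne => (hd s hs hne).add (hd' s hs hne), ?_, ?_⟩
  · have := ht.add ht'
    rw [add_zero] at this
    refine this.congr fun ε => by ring
  · simp only; linarith

theorem PVal.smul {f : ℝ → ℝ} {r L : ℝ} (c : ℝ) (hf : PVal f r L) :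
    PVal (fun s => c * f s) r (c * L) := by
  obtain ⟨hc, H, hH, hd, ht, hL⟩ := hf
  refine ⟨continuousOn_const.mul hc, fun s => c * H s, continuousOn_const.mul hH, fun s hs hne => (hd s hs hne).const_mul c, ?_, ?_⟩
  · have := ht.const_mul c
    rw [mul_zero] at this
    refine this.congr fun ε => by ring
  · simp only; rw [← hL]; ring

theorem PVal.zero {r : ℝ} : PVal (fun _ => 0) r 0 :=
  ⟨continuousOn_const, fun _ => 0, continuousOn_const, fun s _ _ => hasDerivAt_const s _, by simp, by simp⟩

theorem PVal.sum {ι : Type} (S : Finset ι) {f : ι → ℝ → ℝ} {r : ℝ} {L : ι → ℝ}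
    (h : ∀ i ∈ S, PVal (f i) r (L i)) : PVal (fun s => ∑ i ∈ S, f i s) r (∑ i ∈ S, L i) := by
  classical
  induction S using Finset.induction_on with
  | empty => simpa using PVal.zero
  | insert a S ha ih =>
    simp only [Finset.sum_insert ha]
    exact (h a (by simp)).add (ih fun i hi => h i (by simp [hi]))

theorem PVal.congr {f g : ℝ → ℝ} {r L M : ℝ} (hf : PVal f r L)
    (h : ∀ s ∈ Set.Icc (-1 : ℝ) 1, s ≠ r → g s = f s) (hM : M = L) : PVal g r M := by
  obtain ⟨hc, H, hH, hd, ht, hL⟩ := hf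
  refine ⟨hc.congr fun s hs => h s hs.1 hs.2, H, hH, fun s hs hne => ?_, ht, hL.trans hM.symm⟩
  rw [h s ⟨hs.1.le, hs.2.le⟩ hne]; exact hd s hs hne

/-- regular integrands -/
theorem PVal.of_cont {f H : ℝ → ℝ} {r L : ℝ} (hf : Continuous f) (hH : Continuous H)
    (hd : ∀ s ∈ Set.Ioo (-1 : ℝ) 1, HasDerivAt H (f s) s) (hL : H 1 - H (-1) = L) : PVal f r L := by
  refine ⟨hf.continuousOn, H, hH.continuousOn, fun s hs _ => hd s hs, ?_, hL⟩
  have : Continuous fun ε : ℝ => H (r - ε) - H (r + ε) := by fun_prop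
  have h2 := this.tendsto 0
  simp only [sub_zero, add_zero, sub_self] at h2
  exact h2.mono_left nhdsWithin_le_nhds

theorem hasDerivAt_w {s : ℝ} (hs : s ∈ Set.Ioo (-1 : ℝ) 1) :
    HasDerivAt (fun x : ℝ => √(1 - x ^ 2)) (-s / √(1 - s ^ 2)) s := by
  have h1 : (1 - s ^ 2) ≠ 0 := by nlinarith [hs.1, hs.2]
  have := (((hasDerivAt_id s).pow 2).const_sub 1).sqrt (by simpa using h1)
  convert this using 1
  simp
  ring_nf
  rfl

theorem w_pos {s : ℝ} (hs : s ∈ Set.Ioo (-1 : ℝ) 1) : 0 < 1 - s ^ 2 := by nlinarith [hs.1, hs.2]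

theorem pv_w (r : ℝ) : PVal (fun s => √(1 - s ^ 2)) r (Real.pi / 2) := by
  refine PVal.of_cont (H := fun s => (s * √(1 - s ^ 2) + Real.arcsin s) / 2) (by fun_prop)
    (by have := Real.continuous_arcsin; fun_prop) (fun s hs => ?_) ?_
  · have h := (((hasDerivAt_id s).mul (hasDerivAt_w hs)).add
      (Real.hasDerivAt_arcsin hs.1.ne' hs.2.ne)).div_const 2
    refine h.congr_deriv ?_
    have hp := w_pos hs
    have h1 := Real.sqrt_pos.2 hp
    have h2 := Real.sq_sqrt hp.le
    simp only [id]
    field_simp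
    linear_combination -h2
  · simp; ring

theorem pv_Uw (r : ℝ) (k : ℕ) (hk : 1 ≤ k) :
    PVal (fun s => (U ℝ k).eval s * √(1 - s ^ 2)) r 0 := by
  have hk0 : (k : ℝ) ≠ 0 := by positivity
  refine PVal.of_cont (H := fun s => √(1 - s ^ 2) * ((U ℝ (k + 1)).eval s / (k + 2) - (U ℝ (k - 1)).eval s / k) / 2)
    (by fun_prop) (by fun_prop) (fun s hs => ?_) (by simp)
  have h := ((hasDerivAt_w hs).mul ((((U ℝ (k + 1)).hasDerivAt s).div_const ((k : ℝ) + 2)).sub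
    (((U ℝ (k - 1)).hasDerivAt s).div_const (k : ℝ)))).div_const 2
  refine h.congr_deriv ?_
  have hp := w_pos hs
  have h1 := Real.sqrt_pos.2 hp
  have h2 := Real.sq_sqrt hp.le
  have a1 := congrArg (eval s) (add_one_mul_T_eq_poly_in_U (R := ℝ) (k + 1))
  have a2 := congrArg (eval s) (add_one_mul_T_eq_poly_in_U (R := ℝ) (k - 1))
  have a3 := congrArg (eval s) (one_sub_X_sq_mul_U_eq_pol_in_T ℝ k)
  have a4 := congrArg (eval s) (T_add_two ℝ k)
  rw [show (k : ℤ) - 1 + 1 = k by ring] at a2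
  rw [show (k : ℤ) + 1 + 1 = k + 2 by ring] at a1
  simp only [eval_mul, eval_sub, eval_add, eval_pow, eval_X, eval_one, eval_ofNat, Int.cast_add,
    Int.cast_sub, Int.cast_natCast, Int.cast_one, eval_natCast] at a1 a2 a3 a4
  have hk2 : (k : ℝ) + 2 ≠ 0 := by positivity
  have b1 : (T ℝ (k + 2)).eval s = (s * (U ℝ (k + 1)).eval s - (1 - s ^ 2) * (derivative (U ℝ (k+1))).eval s) / (k + 2) := by
    field_simp; linear_combination a1
  have b2 : (T ℝ k).eval s = (s * (U ℝ (k - 1)).eval s - (1 - s ^ 2) * (derivative (U ℝ (k-1))).eval s) / k := by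
    field_simp; linear_combination a2
  have e : ∀ A B A' B' u w : ℝ, 0 < w → w ^ 2 = 1 - s ^ 2 →
     -(s * A - (1 - s^2) * A') + (s * B - (1 - s^2) * B') = 2 * (1 - s^2) * u →
     (-s / w * (A - B) + w * (A' - B')) / 2 = u * w := by
    intro A B A' B' u w hw hw2 h
    field_simp
    rw [hw2]
    linear_combination h
  refine e _ _ _ _ _ _ h1 h2 ?_
  have b3 : s * ((U ℝ (k + 1)).eval s / (k + 2)) - (1 - s ^ 2) * ((derivative (U ℝ (k+1))).eval s / (k + 2)) = (T ℝ (k + 2)).eval s := by rw [b1]; ring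
  have b4 : s * ((U ℝ (k - 1)).eval s / k) - (1 - s ^ 2) * ((derivative (U ℝ (k-1))).eval s / k) = (T ℝ k).eval s := by rw [b2]; ring
  rw [b3, b4]
  linear_combination -2 * a3 + a4

theorem pv_base {r : ℝ} (hr : r ∈ Set.Ioo (-1 : ℝ) 1) :
    PVal (fun s => √(1 - s ^ 2) / (s - r)) r (-Real.pi * r) := by
  have hq := w_pos hr
  have hq1 := Real.sqrt_pos.2 hq
  have hq2 := Real.sq_sqrt hq.le
  set q := √(1 - r ^ 2) with hqdef
  have hne : ∀ s ∈ Set.Icc (-1 : ℝ) 1 \ {r}, s - r ≠ 0 := fun s hs => sub_ne_zero.2 hs.2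
  have hD : ∀ s ∈ Set.Icc (-1 : ℝ) 1, 1 - r * s + q * √(1 - s ^ 2) ≠ 0 := by
    intro s hs
    have := Real.sqrt_nonneg (1 - s ^ 2)
    have h3 : 0 ≤ q * √(1 - s ^ 2) := by positivity
    have : 0 < 1 - r * s := by
      have : s ^ 2 ≤ 1 := by nlinarith [hs.1, hs.2]
      nlinarith [sq_nonneg (r - s)]
    positivity
  refine ⟨ContinuousOn.div (by fun_prop) (by fun_prop) hne,
    fun s => √(1 - s ^ 2) - r * Real.arcsin s + q * (Real.log (s - r) - Real.log (1 - r * s + q * √(1 - s ^ 2))), ?_, ?_, ?_, ?_⟩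
  · have := Real.continuous_arcsin
    refine ContinuousOn.add (by fun_prop) (continuousOn_const.mul (ContinuousOn.sub ?_ ?_))
    · exact ContinuousOn.log (by fun_prop) hne
    · exact ContinuousOn.log (by fun_prop) fun s hs => hD s hs.1
  · intro s hs hsr
    have hw := hasDerivAt_w hs
    have hp := w_pos hs
    have h1 := Real.sqrt_pos.2 hp
    have h2 := Real.sq_sqrt hp.le
    have hd := hD s ⟨hs.1.le, hs.2.le⟩
    have hsr' := sub_ne_zero.2 hsr
    have l1 := ((hasDerivAt_id s).sub_const r).log hsr'
    have l2 := ((((hasDerivAt_id s).const_mul r).const_sub 1).add (hw.const_mul q)).log hd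
    have h := (hw.sub ((Real.hasDerivAt_arcsin hs.1.ne' hs.2.ne).const_mul r)).add ((l1.sub l2).const_mul q)
    refine h.congr_deriv ?_
    simp only [id, Pi.add_apply] at hd ⊢
    clear h l1 l2 hw
    generalize √(1 - s ^ 2) = w at *
    have e1 : 1 / (s - r) - (-(r * 1) + q * (-s / w)) / (1 - r * s + q * w) = q / ((s - r) * w) := by
      rw [div_sub_div _ _ hsr' hd, div_eq_div_iff (by positivity) (by positivity)]
      field_simp
      linear_combination q * h2 - w * hq2
    rw [e1]
    field_simp
    linear_combination hq2 - h2
  · have hc : ContinuousAt (fun s => √(1 - s ^ 2) - r * Real.arcsin s - q * Real.log (1 - r * s + q * √(1 - s ^ 2))) r := by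
      have := Real.continuous_arcsin
      refine ContinuousAt.sub (by fun_prop) (continuousAt_const.mul (ContinuousAt.log (by fun_prop) (hD r ⟨hr.1.le, hr.2.le⟩)))
    have t1 : Filter.Tendsto (fun ε : ℝ => r - ε) (nhdsWithin 0 (Set.Ioi 0)) (nhds r) := by
      have : Continuous fun ε : ℝ => r - ε := by fun_prop
      simpa using (this.tendsto 0).mono_left nhdsWithin_le_nhds
    have t2 : Filter.Tendsto (fun ε : ℝ => r + ε) (nhdsWithin 0 (Set.Ioi 0)) (nhds r) := by
      have : Continuous fun ε : ℝ => r + ε := by fun_prop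
      simpa using (this.tendsto 0).mono_left nhdsWithin_le_nhds
    have := (hc.tendsto.comp t1).sub (hc.tendsto.comp t2)
    rw [sub_self] at this
    refine this.congr fun ε => ?_
    simp only [Function.comp_apply]
    rw [show r - ε - r = -ε by ring, show r + ε - r = ε by ring, Real.log_neg_eq_log]
    ring
  · have : Real.log (-1 - r) = Real.log (1 + r) := by rw [← Real.log_neg_eq_log]; ring_nf
    simp [this]
    ring

theorem pv_U {r : ℝ} (hr : r ∈ Set.Ioo (-1 : ℝ) 1) (k : ℕ) :
    PVal (fun s => (U ℝ k).eval s * √(1 - s ^ 2) / (s - r)) r (-Real.pi * (T ℝ (k + 1)).eval r) := by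
  induction k using Nat.twoStepInduction with
  | zero => exact (pv_base hr).congr (fun s _ _ => by simp) (by simp)
  | one =>
    refine (((pv_base hr).smul (2 * r)).add ((pv_w r).smul 2)).congr (fun s _ hs => ?_) ?_
    · have := sub_ne_zero.2 hs
      simp only [Nat.cast_one, U_one, eval_mul, eval_X, eval_ofNat]
      field_simp
      ring
    · simp only [Nat.cast_one, one_add_one_eq_two, T_two, eval_mul, eval_X, eval_ofNat, eval_sub, eval_pow, eval_one]
      ring
  | more k ih1 ih2 =>
    refine (((ih2.smul (2 * r)).add (ih1.smul (-1))).add ((pv_Uw r (k + 1) (by omega)).smul 2)).congr (fun s _ hs => ?_) ?_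
    · have := sub_ne_zero.2 hs
      push_cast
      rw [U_add_two]
      simp only [eval_mul, eval_X, eval_ofNat, eval_sub]
      field_simp
      ring
    · push_cast
      rw [show (k : ℤ) + 2 + 1 = k + 1 + 2 by ring, T_add_two]
      simp only [eval_mul, eval_X, eval_ofNat, eval_sub]
      ring

theorem pv_main (p n : ℕ) (hn : 2 * (p + 1) + 3 ≤ n) {r : ℝ} (hr : r ∈ Set.Ioo (-1 : ℝ) 1) :
    PVal (fun s => (T ℝ n).eval s * (1 - s ^ 2) ^ (((p + 1 : ℕ) : ℝ) - 1 / 2) / (s - r)) r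
      (∑ j ∈ Finset.range (2 * (p + 1)), ((-1 : ℝ) ^ (p + 1) * (1 / 2) ^ (2 * p + 1)) *
     ((-1 : ℝ) ^ j * ((2 * p + 1).choose j : ℝ)) *
      (-Real.pi * (T ℝ (n - 2 * (p + 1) + 2 * j + 1)).eval r)) := by
  refine (PVal.sum (Finset.range (2 * (p + 1))) (r := r) fun j _ =>
    (pv_U hr (n - 2 * (p + 1) + 2 * j)).smul (((-1 : ℝ) ^ (p + 1) * (1 / 2) ^ (2 * p + 1)) *
     ((-1 : ℝ) ^ j * ((2 * p + 1).choose j : ℝ)))).congr (fun s hs hne => ?_) ?_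
  · have h0 : 0 ≤ 1 - s ^ 2 := by nlinarith [hs.1, hs.2]
    rw [show (((p + 1 : ℕ) : ℝ) - 1 / 2) = (p : ℝ) + 1 / 2 by push_cast; ring,
      Real.rpow_add_of_nonneg h0 (by positivity) (by positivity), Real.rpow_natCast,
      ← Real.sqrt_eq_rpow, ← mul_assoc, aux_expand, mul_div_assoc, Finset.sum_mul]
    refine Finset.sum_congr rfl fun j _ => ?_
    push_cast [Nat.cast_sub (show 2 * (p + 1) ≤ n by omega)]
    ring
  · refine Finset.sum_congr rfl fun j _ => ?_
    push_cast [Nat.cast_sub (show 2 * (p + 1) ≤ n by omega)]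
    ring

theorem hfp4_core (p n : ℕ) (hn : 2 * (p + 1) + 3 ≤ n) (F : ℝ → ℝ) (Q : ℝ[X])
    (hQ : Q = ∑ j ∈ Finset.range (2 * (p + 1)), Polynomial.C (((-1 : ℝ) ^ (p + 1) * (1 / 2) ^ (2 * p + 1)) *
     ((-1 : ℝ) ^ j * ((2 * p + 1).choose j : ℝ)) * (-Real.pi)) * T ℝ (n - 2 * (p + 1) + 2 * j + 1))
    (hF : ∀ r ∈ Set.Ioo (-1 : ℝ) 1,
      Filter.Tendsto
        (fun ε : ℝ =>
          (∫ s in (-1 : ℝ)..(r - ε),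
              (Polynomial.Chebyshev.T ℝ n).eval s * (1 - s ^ 2) ^ (((p + 1 : ℕ) : ℝ) - 1 / 2) / (s - r)) +
          ∫ s in (r + ε)..(1 : ℝ),
              (Polynomial.Chebyshev.T ℝ n).eval s * (1 - s ^ 2) ^ (((p + 1 : ℕ) : ℝ) - 1 / 2) / (s - r))
        (nhdsWithin 0 (Set.Ioi 0)) (nhds (F r))) (r : ℝ) (hr : r ∈ Set.Ioo (-1 : ℝ) 1) : F r = Q.eval r := by
  refine (tendsto_nhds_unique (hF r hr) ((pv_main p n hn hr).tendsto hr)).trans ?_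
  rw [hQ, eval_finsetSum]
  refine Finset.sum_congr rfl fun j _ => ?_
  rw [eval_mul, eval_C]
  ring

/-- Let `m ≥ 1`, `n ≥ 2m + 3` and let `F` be the Cauchy principal value
`F(r) = ⨍_{-1}^{1} T_n(s)(1-s²)^{m-1/2}/(s-r) ds` on `(-1,1)`. Then `F` is three times
differentiable on `(-1,1)` with `F'''(r) = 6 (-1)^{m+1} (1/2)^{2m+2} (1/3) (π/(1-r²)²)
Σ_{j=0}^{2m-1} (-1)^j C(2m-1,j) (n+1-2m+2j) {(n+2-2m+2j)(n+3-2m+2j) U_{n-2-2m+2j}(r)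
- [2(n-2m+2j)² + 4(n-2m+2j) - 6] U_{n-2m+2j}(r)
+ (n-2m+2j)(n-1-2m+2j) U_{n+2-2m+2j}(r)}`; the quartic Hadamard finite-part integral
equals `F'''(r)/6`. -/
theorem hfp4_T_general (m n : ℕ) (hm : 1 ≤ m) (hn : 2 * m + 3 ≤ n) (F : ℝ → ℝ)
    (hF : ∀ r ∈ Set.Ioo (-1 : ℝ) 1,
      Filter.Tendsto
        (fun ε : ℝ =>
          (∫ s in (-1 : ℝ)..(r - ε),
              (Polynomial.Chebyshev.T ℝ n).eval s * (1 - s ^ 2) ^ ((m : ℝ) - 1 / 2) / (s - r)) +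
          ∫ s in (r + ε)..(1 : ℝ),
              (Polynomial.Chebyshev.T ℝ n).eval s * (1 - s ^ 2) ^ ((m : ℝ) - 1 / 2) / (s - r))
        (nhdsWithin 0 (Set.Ioi 0)) (nhds (F r))) :
    ∃ F' F'' : ℝ → ℝ,
      (∀ r ∈ Set.Ioo (-1 : ℝ) 1, HasDerivAt F (F' r) r) ∧
      (∀ r ∈ Set.Ioo (-1 : ℝ) 1, HasDerivAt F' (F'' r) r) ∧
      (∀ r ∈ Set.Ioo (-1 : ℝ) 1,
        HasDerivAt F''
          (6 * ((-1 : ℝ) ^ (m + 1) * (1 / 2 : ℝ) ^ (2 * m + 2) * (1 / 3) *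
            (Real.pi / (1 - r ^ 2) ^ 2) *
            ∑ j ∈ Finset.range (2 * m), (-1 : ℝ) ^ j * (Nat.choose (2 * m - 1) j : ℝ) *
              ((n : ℝ) + 1 - 2 * m + 2 * j) *
              (((n : ℝ) + 2 - 2 * m + 2 * j) * ((n : ℝ) + 3 - 2 * m + 2 * j) *
                  (Polynomial.Chebyshev.U ℝ ((n : ℤ) - 2 - 2 * m + 2 * j)).eval r -
               (2 * ((n : ℝ) - 2 * m + 2 * j) ^ 2 + 4 * ((n : ℝ) - 2 * m + 2 * j) - 6) *
                  (Polynomial.Chebyshev.U ℝ ((n : ℤ) - 2 * m + 2 * j)).eval r +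
               ((n : ℝ) - 2 * m + 2 * j) * ((n : ℝ) - 1 - 2 * m + 2 * j) *
                  (Polynomial.Chebyshev.U ℝ ((n : ℤ) + 2 - 2 * m + 2 * j)).eval r))) r) := by
  obtain ⟨p, rfl⟩ : ∃ p, m = p + 1 := ⟨m - 1, by omega⟩
  obtain ⟨Q, hQ⟩ : ∃ Q : ℝ[X], Q = _ := ⟨_, rfl⟩
  have hFQ := hfp4_core p n hn F Q hQ hF
  refine ⟨fun r => (derivative Q).eval r, fun r => (derivative (derivative Q)).eval r,
    fun r hr => ?_, fun r _ => (derivative Q).hasDerivAt r, fun r hr => ?_⟩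
  · refine (Q.hasDerivAt r).congr_of_eventuallyEq ?_
    filter_upwards [isOpen_Ioo.mem_nhds hr] with x hx using hFQ x hx
  · refine ((derivative (derivative Q)).hasDerivAt r).congr_deriv ?_
    have hp := (w_pos hr).ne'
    rw [hQ]
    simp only [derivative_sum, derivative_mul, derivative_C, zero_mul, zero_add, T_derivative_eq_U,
      derivative_intCast, eval_finsetSum, eval_mul, eval_C, eval_intCast, Finset.mul_sum]
    refine Finset.sum_congr rfl fun j _ => ?_
    have h := aux_Udd ((n : ℤ) - 2 * (p + 1) + 2 * j) r
    rw [show (n : ℤ) - 2 * (p + 1) + 2 * j - 2 = n - 2 - 2 * (p + 1) + 2 * j by ring,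
      show (n : ℤ) - 2 * (p + 1) + 2 * j + 2 = n + 2 - 2 * (p + 1) + 2 * j by ring] at h
    rw [show (n : ℤ) - 2 * (p + 1) + 2 * j + 1 - 1 = n - 2 * (p + 1) + 2 * j by ring]
    rw [show 2 * (p + 1) - 1 = 2 * p + 1 by omega]
    push_cast at h ⊢
    have h' : eval r (derivative (derivative (U ℝ ((n : ℤ) - 2 * (p + 1) + 2 * j)))) = _ :=
      (eq_div_of_mul_eq (by positivity) ((mul_comm _ _).trans h))
    rw [h']
    field_simp
    ring
end
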